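/- If X ⊆ 2^ω is an uncountable saturated λ'-set, then 2^ω \ X (with the subspace topology) is a completely Baire CDH space, i.e. it is countable dense homogeneous and every nonempty closed subspace of it is a Baire space. -/

import Mathlib

open Set

/-- The Cantor space `2^ω`. -/
abbrev Cantor : Type := ℕ → Bool

/-- `X ⊆ 2^ω` is a λ'-set if every countable `Y ⊆ 2^ω` is a relative Gδ-set in `X ∪ Y`. -/
def IsLambdaPrimeSet (X : Set Cantor) : Prop :=
  ∀ Y : Set Cantor, Y.Countable → ∃ G : Set Cantor, IsGδ G ∧ Y = G ∩ (X ∪ Y)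

/-- Tail equivalence on the Cantor space. -/
def TailEquiv (x y : Cantor) : Prop :=
  ∃ m n : ℕ, ∀ k : ℕ, x (m + k) = y (n + k)

/-- The saturation of a set under tail equivalence. -/
def saturation (X : Set Cantor) : Set Cantor :=
  {y | ∃ x ∈ X, TailEquiv y x}

/-- A set is saturated if it equals its tail-equivalence saturation. -/
def Saturated (X : Set Cantor) : Prop := X = saturation X

/-- A space is countable dense homogeneous (CDH) if for any two countable dense subsets
`D`, `E` there is a homeomorphism of the space mapping `D` onto `E`. -/
def IsCDH (X : Type*) [TopologicalSpace X] : Prop :=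
  ∀ D E : Set X, D.Countable → Dense D → E.Countable → Dense E →
    ∃ f : X ≃ₜ X, f '' D = E

lemma TailEquiv.refl (x : Cantor) : TailEquiv x x := ⟨0, 0, fun _ => rfl⟩

lemma TailEquiv.symm {x y : Cantor} (h : TailEquiv x y) : TailEquiv y x := by
  obtain ⟨m, n, h⟩ := h
  exact ⟨n, m, fun k => (h k).symm⟩

lemma TailEquiv.trans {x y z : Cantor} (h : TailEquiv x y) (h' : TailEquiv y z) :
    TailEquiv x z := by
  obtain ⟨m, n, h⟩ := h
  obtain ⟨p, q, h'⟩ := h'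
  refine ⟨m + p, q + n, fun k => ?_⟩
  have h₁ := h (p + k)
  have h₂ := h' (n + k)
  rw [show n + (p + k) = p + (n + k) by ring] at h₁
  rw [add_assoc, add_assoc, h₁, h₂]

lemma countable_setOf_tailEquiv (x : Cantor) : {y | TailEquiv y x}.Countable := by
  simp only [TailEquiv, ofPred_exists]
  refine countable_iUnion fun m => countable_iUnion fun n => ?_
  refine MapsTo.countable_of_injOn (t := (univ : Set (Fin m → Bool)))
    (f := fun y (i : Fin m) => y i) (fun _ _ => mem_univ _) ?_ countable_univ
  intro y hy z hz hyz
  funext i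
  rcases lt_or_ge i m with hi | hi
  · exact congrFun hyz ⟨i, hi⟩
  · obtain ⟨k, rfl⟩ := Nat.exists_eq_add_of_le hi
    exact (hy k).trans (hz k).symm

lemma countable_saturation {A : Set Cantor} (hA : A.Countable) : (saturation A).Countable := by
  have : saturation A = ⋃ x ∈ A, {y | TailEquiv y x} := by
    ext y
    simp [saturation]
  rw [this]
  exact hA.biUnion fun x _ => countable_setOf_tailEquiv x

lemma Saturated.mem_iff {X : Set Cantor} (hX : Saturated X) {x y : Cantor}
    (h : TailEquiv x y) : x ∈ X ↔ y ∈ X := by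
  constructor
  · intro hx
    rw [hX]
    exact ⟨x, hx, h.symm⟩
  · intro hy
    rw [hX]
    exact ⟨y, hy, h⟩

lemma Cantor.exists_forall_of_mem_isOpen {U : Set Cantor} (hU : IsOpen U) {a : Cantor}
    (ha : a ∈ U) : ∃ l, ∀ x : Cantor, (∀ i < l, x i = a i) → x ∈ U := by
  obtain ⟨_, ⟨z, l, rfl⟩, haz, hzU⟩ :=
    (PiNat.isTopologicalBasis_cylinders (fun _ : ℕ => Bool)).exists_subset_of_mem_open ha hU
  refine ⟨l, fun x hx => hzU ?_⟩
  exact fun i hi => (hx i hi).trans (haz i hi)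

lemma Cantor.isOpen_setOf_forall_lt (a : Cantor) (l : ℕ) :
    IsOpen {x : Cantor | ∀ i < l, x i = a i} :=
  PiNat.isOpen_cylinder (fun _ : ℕ => Bool) a l

lemma Cantor.exists_mem_of_dense {E : Set Cantor} (hE : Dense E) (a : Cantor) (l : ℕ) :
    ∃ b ∈ E, ∀ i < l, b i = a i := by
  obtain ⟨b, hb, hbE⟩ :=
    hE.inter_open_nonempty _ (isOpen_setOf_forall_lt a l) ⟨a, fun _ _ => rfl⟩
  exact ⟨b, hbE, hb⟩

lemma dense_setOf_tailEquiv (a : Cantor) : Dense {y | TailEquiv y a} := by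
  rw [dense_iff_inter_open]
  rintro U hU ⟨x, hx⟩
  obtain ⟨l, hl⟩ := Cantor.exists_forall_of_mem_isOpen hU hx
  refine ⟨fun i => if i < l then x i else a i, hl _ fun i hi => by simp [hi], l, l, fun k => ?_⟩
  simp

lemma Cantor.continuous_of_prefix {h : Cantor → Cantor}
    (hh : ∀ n x y, (∀ i < n, x i = y i) → ∀ i < n, h x i = h y i) : Continuous h := by
  refine continuous_def.2 fun U hU => isOpen_iff_forall_mem_open.2 fun a ha => ?_
  obtain ⟨l, hl⟩ := exists_forall_of_mem_isOpen hU ha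
  exact ⟨{x | ∀ i < l, x i = a i}, fun x hx => hl _ (hh l x a hx), isOpen_setOf_forall_lt a l,
    fun _ _ => rfl⟩

/-- The automorphism of the binary tree that sends the branch `a` to the branch `b` and only
changes a finite initial segment of every other branch. -/
def branchSwap (a b x : Cantor) : Cantor :=
  fun i => xor (x i) (if ∀ j < i, x j = a j then xor (a i) (b i) else false)

lemma branchSwap_self (a b : Cantor) : branchSwap a b a = b := by
  funext i
  simp [branchSwap]

lemma branchSwap_prefix (a b : Cantor) {x y : Cantor} {n : ℕ} (h : ∀ i < n, x i = y i) :
    ∀ i < n, branchSwap a b x i = branchSwap a b y i := by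
  intro i hi
  have : (∀ j < i, x j = a j) ↔ ∀ j < i, y j = a j :=
    forall₂_congr fun j hj => by rw [h j (hj.trans hi)]
  simp only [branchSwap, h i hi, this]

lemma branchSwap_branchSwap (a b x : Cantor) : branchSwap b a (branchSwap a b x) = x := by
  have key : ∀ i, (∀ j < i, branchSwap a b x j = b j) ↔ ∀ j < i, x j = a j := by
    intro i
    induction i with
    | zero => simp
    | succ i ih =>
      simp only [Nat.forall_lt_succ_right, ih]
      refine and_congr_right fun hi => ?_
      simp only [branchSwap, if_pos hi]
      cases x i <;> cases a i <;> cases b i <;> simp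
  funext i
  rw [branchSwap]
  simp only [key i]
  rw [branchSwap]
  split_ifs <;> cases x i <;> cases a i <;> cases b i <;> rfl

lemma branchSwap_of_ne {a b x : Cantor} {l j : ℕ} (hab : ∀ i < l, b i = a i) (hj : j < l)
    (hx : x j ≠ a j) : branchSwap a b x = x := by
  funext i
  rw [branchSwap]
  split_ifs with h
  · have hi : i ≤ j := by
      by_contra! hij
      exact hx (h j hij)
    simp [hab i (hi.trans_lt hj)]
  · simp

lemma branchSwap_prefix_eq {a b : Cantor} {l : ℕ} (hab : ∀ i < l, b i = a i) (x : Cantor) :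
    ∀ i < l, branchSwap a b x i = x i := by
  intro i hi
  simp [branchSwap, hab i hi]

lemma tailEquiv_branchSwap {a x : Cantor} (b : Cantor) (h : x ≠ a) :
    TailEquiv (branchSwap a b x) x := by
  obtain ⟨j, hj⟩ := Function.ne_iff.1 h
  refine ⟨j + 1, j + 1, fun k => ?_⟩
  have : ¬ ∀ i < j + 1 + k, x i = a i := fun H => hj (H j (by lia))
  rw [branchSwap, if_neg this, Bool.xor_false]

/-- `branchSwap a b` as a permutation of the Cantor space. -/
def branchSwapEquiv (a b : Cantor) : Cantor ≃ Cantor where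
  toFun := branchSwap a b
  invFun := branchSwap b a
  left_inv := branchSwap_branchSwap a b
  right_inv := branchSwap_branchSwap b a

/-- A tree automorphism `h` that preserves tail equivalence classes off the finite set `P ⊆ D`,
which it maps into `E`. -/
structure IsApprox (D E : Set Cantor) (h : Cantor ≃ Cantor) (P : Set Cantor) : Prop where
  prefix_iff : ∀ n x y, (∀ i < n, h x i = h y i) ↔ ∀ i < n, x i = y i
  finite : P.Finite
  subset : P ⊆ D
  mapsTo : ∀ x ∈ P, h x ∈ E
  tailEquiv : ∀ x ∉ P, TailEquiv (h x) x

/-- `(h', P')` extends `(h, P)`, with agreement on `K` and in the first `n` coordinates. -/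
structure ApproxExtends (n : ℕ) (K : Set Cantor) (h : Cantor ≃ Cantor) (P : Set Cantor)
    (h' : Cantor ≃ Cantor) (P' : Set Cantor) : Prop where
  subset : P ⊆ P'
  eqOn_dom : ∀ x ∈ P, h' x = h x
  eqOn : ∀ x ∈ K, h' x = h x
  eqOn_symm : ∀ x ∈ K, h'.symm x = h.symm x
  agree : ∀ x, ∀ i < n, h' x i = h x i
  agree_symm : ∀ x, ∀ i < n, h'.symm x i = h.symm x i

section

variable {D E K P P' P'' : Set Cantor} {h h' h'' : Cantor ≃ Cantor} {n : ℕ}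

lemma isApprox_refl (D E : Set Cantor) : IsApprox D E (Equiv.refl _) ∅ where
  prefix_iff _ _ _ := Iff.rfl
  finite := finite_empty
  subset := empty_subset _
  mapsTo _ hx := hx.elim
  tailEquiv x _ := TailEquiv.refl x

lemma IsApprox.symm (H : IsApprox D E h P) : IsApprox E D h.symm (h '' P) where
  prefix_iff n x y := by
    rw [← H.prefix_iff]
    simp
  finite := H.finite.image h
  subset := image_subset_iff.2 H.mapsTo
  mapsTo := by
    rintro _ ⟨x, hx, rfl⟩
    simpa using H.subset hx
  tailEquiv y hy := by
    have := H.tailEquiv (h.symm y) fun hmem => hy ⟨_, hmem, by simp⟩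
    simpa using this.symm

lemma ApproxExtends.refl (n : ℕ) (K : Set Cantor) (h : Cantor ≃ Cantor) (P : Set Cantor) :
    ApproxExtends n K h P h P := by
  constructor <;> simp

lemma ApproxExtends.trans (H : ApproxExtends n K h P h' P')
    (H' : ApproxExtends n K h' P' h'' P'') : ApproxExtends n K h P h'' P'' where
  subset := H.subset.trans H'.subset
  eqOn_dom x hx := (H'.eqOn_dom x (H.subset hx)).trans (H.eqOn_dom x hx)
  eqOn x hx := (H'.eqOn x hx).trans (H.eqOn x hx)
  eqOn_symm x hx := (H'.eqOn_symm x hx).trans (H.eqOn_symm x hx)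
  agree x i hi := (H'.agree x i hi).trans (H.agree x i hi)
  agree_symm x i hi := (H'.agree_symm x i hi).trans (H.agree_symm x i hi)

lemma ApproxExtends.mono {m : ℕ} {L : Set Cantor} (H : ApproxExtends n K h P h' P')
    (hm : m ≤ n) (hL : L ⊆ K) : ApproxExtends m L h P h' P' where
  subset := H.subset
  eqOn_dom := H.eqOn_dom
  eqOn x hx := H.eqOn x (hL hx)
  eqOn_symm x hx := H.eqOn_symm x (hL hx)
  agree x i hi := H.agree x i (hi.trans_le hm)
  agree_symm x i hi := H.agree_symm x i (hi.trans_le hm)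

lemma ApproxExtends.symm_left (H : ApproxExtends n K h.symm (h '' P) h' P') :
    ApproxExtends n K h P h'.symm (h' '' P') where
  subset x hx := ⟨h x, H.subset ⟨x, hx, rfl⟩, by simpa using H.eqOn_dom (h x) ⟨x, hx, rfl⟩⟩
  eqOn_dom x hx := by
    rw [Equiv.symm_apply_eq]
    simpa using (H.eqOn_dom (h x) ⟨x, hx, rfl⟩).symm
  eqOn x hx := by simpa using H.eqOn_symm x hx
  eqOn_symm x hx := by simpa using H.eqOn x hx
  agree x i hi := by simpa using H.agree_symm x i hi
  agree_symm x i hi := by simpa using H.agree x i hi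

lemma IsApprox.exists_extends_mem (H : IsApprox D E h P) (hE : Dense E) (hK : IsClosed K)
    {d : Cantor} (hd : d ∈ D) (hdK : ∀ y, TailEquiv y d → y ∉ K) (n : ℕ) :
    ∃ h' P', IsApprox D E h' P' ∧ ApproxExtends n K h P h' P' ∧ d ∈ P' := by
  by_cases hdP : d ∈ P
  · exact ⟨h, P, H, .refl .., hdP⟩
  obtain ⟨l₁, hl₁⟩ := Cantor.exists_forall_of_mem_isOpen (a := d)
    (hK.union H.finite.isClosed).isOpen_compl (by simp [hdP, hdK d (.refl d)])
  obtain ⟨l₂, hl₂⟩ := Cantor.exists_forall_of_mem_isOpen (a := h d)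
    hK.isOpen_compl (hdK _ (H.tailEquiv d hdP))
  set l := max n (max l₁ l₂)
  obtain ⟨b, hbE, hb⟩ := Cantor.exists_mem_of_dense hE (h d) l
  have hfix : ∀ x ∈ K ∪ P, branchSwap (h d) b (h x) = h x := by
    intro x hx
    by_contra hne
    have hxd : ∀ i < l, h x i = h d i := by
      intro i hi
      by_contra hi'
      exact hne (branchSwap_of_ne hb hi hi')
    rw [H.prefix_iff] at hxd
    exact hl₁ x (fun i hi => hxd i (by lia)) hx
  have hfix' : ∀ y ∈ K, branchSwap b (h d) y = y := by
    intro y hy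
    by_contra hne
    refine hl₂ y (fun i hi => ?_) hy
    by_contra hi'
    have hil : i < l := by lia
    exact hne (branchSwap_of_ne (fun i hi => (hb i hi).symm) hil (by rwa [hb i hil]))
  refine ⟨h.trans (branchSwapEquiv (h d) b), insert d P, ?_, ?_, mem_insert _ _⟩
  · constructor
    · intro m x y
      refine (?_ : _ ↔ _).trans (H.prefix_iff m x y)
      refine ⟨fun hxy => ?_, branchSwap_prefix _ _⟩
      have := branchSwap_prefix b (h d) hxy
      simpa [branchSwapEquiv, branchSwap_branchSwap] using this
    · exact H.finite.insert d
    · exact insert_subset hd H.subset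
    · rintro x (rfl | hx)
      · simpa [branchSwapEquiv, branchSwap_self] using hbE
      · simpa [branchSwapEquiv, hfix x (.inr hx)] using H.mapsTo x hx
    · intro x hx
      rw [mem_insert_iff, not_or] at hx
      exact (tailEquiv_branchSwap b (h.injective.ne hx.1)).trans (H.tailEquiv x hx.2)
  · refine ⟨subset_insert _ _, fun x hx => hfix x (.inr hx), fun x hx => hfix x (.inl hx),
      fun x hx => ?_, fun x i hi => branchSwap_prefix_eq hb (h x) i (by lia), fun x i hi => ?_⟩
    · exact congrArg h.symm (hfix' x hx)
    · refine (H.symm.prefix_iff n _ _).2 (fun j hj => ?_) i hi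
      exact branchSwap_prefix_eq (fun i hi => (hb i hi).symm) x j (by lia)

lemma IsApprox.exists_extends (H : IsApprox D E h P) (hD : Dense D) (hE : Dense E)
    (hK : IsClosed K) {d e : Cantor} (hd : d ∈ D) (he : e ∈ E)
    (hdK : ∀ y, TailEquiv y d → y ∉ K) (heK : ∀ y, TailEquiv y e → y ∉ K) (n : ℕ) :
    ∃ h' P', IsApprox D E h' P' ∧ ApproxExtends n K h P h' P' ∧ d ∈ P' ∧ e ∈ h' '' P' := by
  obtain ⟨h₁, P₁, H₁, hext₁, hd₁⟩ := H.exists_extends_mem hE hK hd hdK n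
  obtain ⟨h₂, P₂, H₂, hext₂, he₂⟩ := H₁.symm.exists_extends_mem hD hK he heK n
  exact ⟨h₂.symm, h₂ '' P₂, H₂.symm, hext₁.trans hext₂.symm_left, hext₂.symm_left.subset hd₁,
    by simpa using he₂⟩

end

/-- If `G` is a Gδ-set that contains every point tail equivalent to a point of one of the countable
dense sets `D` and `E`, then some autohomeomorphism of the Cantor space maps `D` onto `E` and
preserves the tail equivalence class of each point outside `G`. -/
theorem exists_homeomorph_image_eq_and_tailEquiv {D E G : Set Cantor} (hDc : D.Countable)
    (hD : Dense D) (hEc : E.Countable) (hE : Dense E) (hG : IsGδ G)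
    (hDG : ∀ x ∈ D, ∀ y, TailEquiv y x → y ∈ G) (hEG : ∀ x ∈ E, ∀ y, TailEquiv y x → y ∈ G) :
    ∃ h : Cantor ≃ₜ Cantor, h '' D = E ∧ (∀ x ∉ G, TailEquiv (h x) x) ∧
      ∀ y ∉ G, TailEquiv (h.symm y) y := by
  obtain ⟨d, rfl⟩ := hDc.exists_eq_range hD.nonempty
  obtain ⟨e, rfl⟩ := hEc.exists_eq_range hE.nonempty
  obtain ⟨U, hU, hGU⟩ := isGδ_iff_eq_iInter_nat.1 hG
  let K : ℕ → Set Cantor := fun n => ⋃ i ∈ Iic n, (U i)ᶜ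
  have hK : ∀ n, IsClosed (K n) := fun n =>
    (finite_Iic n).isClosed_biUnion fun i _ => (hU i).isClosed_compl
  have hKmono : Monotone K := fun m n hmn =>
    biUnion_subset_biUnion_left (Iic_subset_Iic.2 hmn)
  have hKG : ∀ n, ∀ x ∈ K n, x ∉ G := by
    intro n x hx hxG
    obtain ⟨i, -, hi⟩ := mem_iUnion₂.1 hx
    rw [hGU] at hxG
    exact hi (mem_iInter.1 hxG i)
  have hexK : ∀ x ∉ G, ∃ n, x ∈ K n := by
    intro x hx
    rw [hGU, mem_iInter, not_forall] at hx
    obtain ⟨n, hn⟩ := hx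
    exact ⟨n, mem_iUnion₂.2 ⟨n, mem_Iic.2 le_rfl, hn⟩⟩
  let S := {p : (Cantor ≃ Cantor) × Set Cantor // IsApprox (range d) (range e) p.1 p.2}
  have hstep : ∀ n (s : S), ∃ s' : S, ApproxExtends n (K n) s.1.1 s.1.2 s'.1.1 s'.1.2 ∧
      d n ∈ s'.1.2 ∧ e n ∈ s'.1.1 '' s'.1.2 := by
    rintro n ⟨⟨h, P⟩, H⟩
    obtain ⟨h', P', H', hr⟩ := H.exists_extends hD hE (hK n) (mem_range_self n) (mem_range_self n)
      (fun y hy hyK => hKG n y hyK (hDG _ (mem_range_self n) y hy))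
      (fun y hy hyK => hKG n y hyK (hEG _ (mem_range_self n) y hy)) n
    exact ⟨⟨⟨h', P'⟩, H'⟩, hr⟩
  choose next hnext using hstep
  let s : ℕ → S := fun n => Nat.rec ⟨(Equiv.refl _, ∅), isApprox_refl _ _⟩ next n
  let f : ℕ → Cantor ≃ Cantor := fun n => (s n).1.1
  let P : ℕ → Set Cantor := fun n => (s n).1.2
  have hf : ∀ n, IsApprox (range d) (range e) (f n) (P n) := fun n => (s n).2
  have hext : ∀ n m, n ≤ m → ApproxExtends n (K n) (f n) (P n) (f m) (P m) := by
    intro n m hnm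
    induction m, hnm using Nat.le_induction with
    | base => exact .refl ..
    | succ m hnm ih => exact ih.trans ((hnext m (s m)).1.mono hnm (hKmono hnm))
  have hdP : ∀ n, d n ∈ P (n + 1) := fun n => (hnext n (s n)).2.1
  have heP : ∀ n, e n ∈ f (n + 1) '' P (n + 1) := fun n => (hnext n (s n)).2.2
  let g : Cantor → Cantor := fun x i => f (i + 1) x i
  let g' : Cantor → Cantor := fun x i => (f (i + 1)).symm x i
  have hg : ∀ n x, ∀ i < n, g x i = f n x i := fun n x i hi =>
    ((hext (i + 1) n hi).agree x i (Nat.lt_succ_self i)).symm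
  have hg' : ∀ n x, ∀ i < n, g' x i = (f n).symm x i := fun n x i hi =>
    ((hext (i + 1) n hi).agree_symm x i (Nat.lt_succ_self i)).symm
  have hgeq : ∀ n x, (∀ m ≥ n, f m x = f n x) → g x = f n x := by
    intro n x hx
    funext i
    rw [hg (max n (i + 1)) x i (by lia), hx _ (le_max_left _ _)]
  have hg'eq : ∀ n x, (∀ m ≥ n, (f m).symm x = (f n).symm x) → g' x = (f n).symm x := by
    intro n x hx
    funext i
    rw [hg' (max n (i + 1)) x i (by lia), hx _ (le_max_left _ _)]
  have hgP : ∀ n, ∀ x ∈ P n, g x = f n x := fun n x hx =>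
    hgeq n x fun m hm => (hext n m hm).eqOn_dom x hx
  let h : Cantor ≃ₜ Cantor :=
    { toFun := g
      invFun := g'
      left_inv := fun x => by
        funext i
        rw [hg' (i + 1) (g x) i (Nat.lt_succ_self i),
          ((hf (i + 1)).symm.prefix_iff (i + 1) _ _).2 (hg (i + 1) x) i (Nat.lt_succ_self i),
          Equiv.symm_apply_apply]
      right_inv := fun x => by
        funext i
        rw [hg (i + 1) (g' x) i (Nat.lt_succ_self i),
          ((hf (i + 1)).prefix_iff (i + 1) _ _).2 (hg' (i + 1) x) i (Nat.lt_succ_self i),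
          Equiv.apply_symm_apply]
      continuous_toFun := Cantor.continuous_of_prefix fun n x y hxy i hi => by
        rw [hg n x i hi, hg n y i hi, ((hf n).prefix_iff n x y).2 hxy i hi]
      continuous_invFun := Cantor.continuous_of_prefix fun n x y hxy i hi => by
        rw [hg' n x i hi, hg' n y i hi, ((hf n).symm.prefix_iff n x y).2 hxy i hi] }
  refine ⟨h, Subset.antisymm ?_ ?_, fun x hx => ?_, fun y hy => ?_⟩
  · rintro _ ⟨_, ⟨n, rfl⟩, rfl⟩
    change g (d n) ∈ range e
    rw [hgP (n + 1) _ (hdP n)]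
    exact (hf (n + 1)).mapsTo _ (hdP n)
  · rintro _ ⟨n, rfl⟩
    obtain ⟨x, hx, hxe⟩ := heP n
    exact ⟨x, (hf (n + 1)).subset hx, (hgP (n + 1) _ hx).trans hxe⟩
  · obtain ⟨n, hn⟩ := hexK x hx
    change TailEquiv (g x) x
    rw [hgeq n x fun m hm => (hext n m hm).eqOn x hn]
    exact (hf n).tailEquiv x fun hxP => hx (hDG x ((hf n).subset hxP) x (.refl x))
  · obtain ⟨n, hn⟩ := hexK y hy
    change TailEquiv (g' y) y
    rw [hg'eq n y fun m hm => (hext n m hm).eqOn_symm y hn]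
    exact (hf n).symm.tailEquiv y fun hyP => hy (hEG y ((hf n).symm.subset hyP) y (.refl y))

lemma IsLambdaPrimeSet.exists_isGδ {X Y : Set Cantor} (hX : IsLambdaPrimeSet X)
    (hY : Y.Countable) (hXY : Disjoint Y X) : ∃ G, IsGδ G ∧ Y ⊆ G ∧ Disjoint G X := by
  obtain ⟨G, hG, hYG⟩ := hX Y hY
  refine ⟨G, hG, fun y hy => (hYG.subset hy).1, disjoint_left.2 fun x hxG hxX => ?_⟩
  exact disjoint_left.1 hXY (hYG.superset ⟨hxG, .inl hxX⟩) hxX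

theorem isCDH_compl {X : Set Cantor} (hsat : Saturated X) (hlam : IsLambdaPrimeSet X) :
    IsCDH ↥(Xᶜ) := by
  intro D E hDc hD hEc hE
  rcases isEmpty_or_nonempty ↥(Xᶜ) with hemp | ⟨⟨z, hz⟩⟩
  · exact ⟨Homeomorph.refl _, Subsingleton.elim _ _⟩
  have hXd : Dense Xᶜ :=
    (dense_setOf_tailEquiv z).mono fun y hy hyX => hz ((hsat.mem_iff hy).1 hyX)
  have hdense : ∀ A : Set ↥(Xᶜ), Dense A → Dense (Subtype.val '' A) := fun A hA =>
    hXd.denseRange_val.dense_image continuous_subtype_val hA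
  have hdisj : Disjoint (saturation (Subtype.val '' D ∪ Subtype.val '' E)) X := by
    rw [disjoint_left]
    rintro y ⟨x, hx, hyx⟩ hyX
    rw [hsat.mem_iff hyx] at hyX
    rcases hx with ⟨w, -, rfl⟩ | ⟨w, -, rfl⟩ <;> exact w.2 hyX
  obtain ⟨G, hG, hsub, hGX⟩ :=
    hlam.exists_isGδ (countable_saturation ((hDc.image _).union (hEc.image _))) hdisj
  obtain ⟨h, himg, hh, hh'⟩ := exists_homeomorph_image_eq_and_tailEquiv (hDc.image _)
    (hdense D hD) (hEc.image _) (hdense E hE) hG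
    (fun x hx y hy => hsub ⟨x, .inl hx, hy⟩) (fun x hx y hy => hsub ⟨x, .inr hx, hy⟩)
  have hX : ∀ x, x ∈ Xᶜ ↔ h x ∈ Xᶜ := by
    intro x
    refine not_congr ⟨fun hx => ?_, fun hx => ?_⟩
    · exact (hsat.mem_iff (hh x (disjoint_right.1 hGX hx))).2 hx
    · have := (hsat.mem_iff (hh' _ (disjoint_right.1 hGX hx))).2 hx
      simpa using this
  refine ⟨h.subtype hX, Subtype.val_injective.image_injective ?_⟩
  rw [← himg, image_image, image_image]
  rfl

lemma baireSpace_of_isDenseInducing {T Y : Type*} [TopologicalSpace T] [TopologicalSpace Y]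
    [BaireSpace Y] {j : T → Y} (hj : IsDenseInducing j) {G : Set Y} (hG : IsGδ G)
    (hGd : Dense G) (hGj : G ⊆ range j) : BaireSpace T := by
  refine ⟨fun f ho hd => ?_⟩
  choose V hV hVf using fun n => hj.isOpen_iff.1 (ho n)
  have hVd : ∀ n, Dense (V n) := fun n =>
    (hj.dense.dense_image hj.continuous (hd n)).mono (by
      rw [← hVf n]
      exact image_preimage_subset _ _)
  have hdense : Dense ((⋂ n, V n) ∩ G) :=
    (dense_iInter_of_isOpen_nat hV hVd).inter_of_Gδ
      (.iInter_of_isOpen hV) hG hGd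
  rw [dense_iff_inter_open]
  rintro O hO ⟨t, ht⟩
  obtain ⟨O', hO', rfl⟩ := hj.isOpen_iff.1 hO
  obtain ⟨y, hy, hyV, hyG⟩ := hdense.inter_open_nonempty O' hO' ⟨j t, ht⟩
  obtain ⟨u, rfl⟩ := hGj hyG
  refine ⟨u, hy, mem_iInter.2 fun n => ?_⟩
  rw [← hVf n]
  exact mem_iInter.1 hyV n

theorem baireSpace_of_isClosed_compl {X : Set Cantor} (hlam : IsLambdaPrimeSet X)
    {F : Set ↥(Xᶜ)} (hF : IsClosed F) : BaireSpace ↥F := by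
  set A : Set Cantor := Subtype.val '' F
  obtain ⟨S, hSc, hSd⟩ := TopologicalSpace.exists_countable_dense ↥F
  obtain ⟨G, hG, hSG, hGX⟩ := hlam.exists_isGδ
    (Y := (fun x : F => x.1.1) '' S) (hSc.image _) (by
      rw [disjoint_left]
      rintro _ ⟨x, -, rfl⟩
      exact x.1.2)
  have : CompactSpace ↥(closure A) := isCompact_iff_compactSpace.1 isClosed_closure.isCompact
  let j : F → closure A := fun x => ⟨x.1.1, subset_closure ⟨x.1, x.2, rfl⟩⟩
  have hind : Topology.IsInducing j := by
    have hval : Topology.IsInducing fun x : F => x.1.1 :=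
      Topology.IsInducing.subtypeVal.comp Topology.IsInducing.subtypeVal
    exact Topology.IsInducing.subtypeVal.of_comp_iff.1 hval
  have hjd : DenseRange j := by
    intro y
    rw [closure_subtype, ← range_comp]
    have : range (Subtype.val ∘ j) = A := by
      ext x
      simp [j, A]
    rw [this]
    exact y.2
  refine baireSpace_of_isDenseInducing ⟨hind, hjd⟩ (G := Subtype.val ⁻¹' G)
    (hG.preimage continuous_subtype_val) ?_ ?_
  · refine (hjd.dense_image hind.continuous hSd).mono ?_
    rintro _ ⟨x, hx, rfl⟩
    exact hSG ⟨x, hx, rfl⟩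
  · rintro ⟨y, hy⟩ hyG
    have hyX : y ∈ Xᶜ := disjoint_left.1 hGX hyG
    have : (⟨y, hyX⟩ : ↥(Xᶜ)) ∈ F := by
      rw [← hF.closure_eq, closure_subtype]
      exact hy
    exact ⟨⟨_, this⟩, rfl⟩

/-- If `X ⊆ 2^ω` is an uncountable saturated λ'-set, then `2^ω \ X` is a completely
Baire CDH space: it is CDH and every nonempty closed subspace of it is Baire. -/
theorem complement_CDH_completelyBaire (X : Set Cantor)
    (hunc : ¬ X.Countable) (hsat : Saturated X) (hlam : IsLambdaPrimeSet X) :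
    IsCDH ↥(Xᶜ) ∧ ∀ F : Set ↥(Xᶜ), IsClosed F → F.Nonempty → BaireSpace ↥F :=
  ⟨isCDH_compl hsat hlam, fun _ hF _ => baireSpace_of_isClosed_compl hlam hF⟩
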